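/- Let ν ≥ 1 and let P(X) = c_ν X^ν + ⋯ + c_1 X ∈ ℤ[X] be a polynomial with nonzero discriminant, set f_P(d) = #{1 ≤ a ≤ d : P(a) ≡ 0 (mod d)} and K(n) = Σ_{d | n} μ(d)·f_P(d)/d. Then for every Dirichlet character χ modulo q and every complex number s with Re(s) > 2, the Dirichlet series Σ_{n=1}^∞ χ(n)·K(n)·n^{1−s} converges absolutely and equals L(s−1, χ) · ∏_p (1 − χ(p)·f_P(p)·p^{−s}), where L(·,χ) is the Dirichlet L-function of χ and the product over primes p converges absolutely. -/

import Mathlib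

open Finset Filter

/-- The pairs `(a, q)` with `1 ≤ a ≤ q ≤ Q` and `gcd (P(a), q) = 1`, indexing the
polynomial Farey fractions `a / q` of order `Q`. -/
def fareyPairs (P : Polynomial ℤ) (Q : ℕ) : Finset (ℕ × ℕ) :=
  (Finset.Icc 1 Q ×ˢ Finset.Icc 1 Q).filter
    (fun x => x.1 ≤ x.2 ∧ Int.gcd (P.eval (x.1 : ℤ)) (x.2 : ℤ) = 1)

/-- The set of polynomial Farey fractions of order `Q`. -/
def fareySet (P : Polynomial ℤ) (Q : ℕ) : Finset ℚ :=
  (fareyPairs P Q).image (fun x => (x.1 : ℚ) / (x.2 : ℚ))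

/-- `f_P(m)` is the number of `1 ≤ d ≤ m` with `P(d) ≡ 0 (mod m)`. -/
def fP (P : Polynomial ℤ) (m : ℕ) : ℕ :=
  ((Finset.Icc 1 m).filter (fun d : ℕ => (m : ℤ) ∣ P.eval (d : ℤ))).card

/-- `β_P = ∏_p (1 - f_P(p)/p²)`, the product over all primes. -/
noncomputable def betaP (P : Polynomial ℤ) : ℝ :=
  ∏' p : Nat.Primes, (1 - (fP P (p : ℕ) : ℝ) / ((p : ℕ) : ℝ) ^ 2)

open scoped Classical in
/-- Pair correlation measure `S_F(Λ)` of a finite set `F ⊂ ℝ/ℤ` (represented by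
rationals): `(1/N) · #{(a,b) ∈ F² : a ≠ b, a - b ∈ (1/N)(0,Λ) + ℤ}`. -/
noncomputable def pairCorr (F : Finset ℚ) (Λ : ℝ) : ℝ :=
  (((F ×ˢ F).filter (fun x => x.1 ≠ x.2 ∧
      ∃ k : ℤ, ((x.1 : ℝ) - (x.2 : ℝ) - (k : ℝ)) * (F.card : ℝ) ∈ Set.Ioo 0 Λ)).card : ℝ) /
    (F.card : ℝ)

/-- `K(n) = Σ_{d ∣ n} μ(d) f_P(d) / d`. -/
noncomputable def Kfun (P : Polynomial ℤ) (n : ℕ) : ℂ :=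
  ∑ d ∈ n.divisors, (ArithmeticFunction.moebius d : ℂ) * (fP P d : ℂ) / (d : ℂ)


lemma fP_eq_card (P : Polynomial ℤ) (m : ℕ) [NeZero m] :
    fP P m = Fintype.card {x : ZMod m // (P.map (Int.castRingHom (ZMod m))).eval x = 0} := by
  rw [fP, Fintype.card_subtype]
  have key : ∀ a : ℕ, (m : ℤ) ∣ P.eval (a : ℤ) ↔
      (P.map (Int.castRingHom (ZMod m))).eval (a : ZMod m) = 0 := by
    intro a
    rw [← ZMod.intCast_zmod_eq_zero_iff_dvd]
    have := Polynomial.eval_map_apply (f := Int.castRingHom (ZMod m)) (p := P) (a : ℤ)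
    simp only [eq_intCast, Int.cast_natCast] at this
    rw [this]
  refine Finset.card_bij (fun a _ => (a : ZMod m)) ?_ ?_ ?_
  · intro a ha
    simp only [Finset.mem_filter, Finset.mem_univ, true_and] at ha ⊢
    exact (key a).1 ha.2
  · intro a ha b hb h
    simp only [Finset.mem_filter, Finset.mem_Icc] at ha hb
    rw [ZMod.natCast_eq_natCast_iff] at h
    have h1 : (m : ℤ) ∣ (b : ℤ) - a := h.dvd
    obtain ⟨k, hk⟩ := h1
    have hm : (0 : ℤ) < m := by exact_mod_cast Nat.pos_of_ne_zero (NeZero.ne m)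
    have h2 : k < 1 := by
      by_contra hc
      have : (m : ℤ) * 1 ≤ m * k := by gcongr; omega
      omega
    have h3 : -1 < k := by
      by_contra hc
      have : (m : ℤ) * k ≤ m * (-1) := by gcongr; omega
      omega
    have : k = 0 := by omega
    subst this
    omega
  · intro x hx
    simp only [Finset.mem_filter, Finset.mem_univ, true_and] at hx
    by_cases h0 : x.val = 0
    · refine ⟨m, ?_, ?_⟩
      · simp only [Finset.mem_filter, Finset.mem_Icc]
        refine ⟨⟨Nat.pos_of_ne_zero (NeZero.ne m), le_rfl⟩, (key m).2 ?_⟩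
        rw [ZMod.val_eq_zero] at h0
        simpa [h0] using hx
      · rw [ZMod.val_eq_zero] at h0
        simp [h0]
    · refine ⟨x.val, ?_, by simp⟩
      simp only [Finset.mem_filter, Finset.mem_Icc]
      refine ⟨⟨by omega, (ZMod.val_lt x).le⟩, (key _).2 ?_⟩
      simpa using hx

lemma eval_map_hom (P : Polynomial ℤ) {R S : Type*} [CommRing R] [CommRing S] (e : R →+* S) (x : R) :
    (P.map (Int.castRingHom S)).eval (e x) = e ((P.map (Int.castRingHom R)).eval x) := by
  rw [← Polynomial.eval_map_apply, Polynomial.map_map]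
  congr 2
  exact RingHom.ext_int _ _

lemma fP_mul (P : Polynomial ℤ) {m n : ℕ} (hm : m ≠ 0) (hn : n ≠ 0) (h : m.Coprime n) :
    fP P (m * n) = fP P m * fP P n := by
  have : NeZero m := ⟨hm⟩
  have : NeZero n := ⟨hn⟩
  rw [fP_eq_card P m, fP_eq_card P n, fP_eq_card P (m * n), ← Fintype.card_prod]
  refine Fintype.card_congr (Equiv.trans (Equiv.subtypeEquiv (ZMod.chineseRemainder h).toEquiv
    (q := fun y => (P.map (Int.castRingHom (ZMod m))).eval y.1 = 0 ∧
      (P.map (Int.castRingHom (ZMod n))).eval y.2 = 0) ?_) (Equiv.subtypeProdEquivProd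
    (p := fun y => (P.map (Int.castRingHom (ZMod m))).eval y = 0)
    (q := fun y => (P.map (Int.castRingHom (ZMod n))).eval y = 0)))
  intro x
  let e := ZMod.chineseRemainder h
  have h1 := eval_map_hom P ((RingHom.fst (ZMod m) (ZMod n)).comp (e : ZMod (m * n) →+* _)) x
  have h2 := eval_map_hom P ((RingHom.snd (ZMod m) (ZMod n)).comp (e : ZMod (m * n) →+* _)) x
  change Polynomial.eval (e x).1 _ = (e _).1 at h1
  change Polynomial.eval (e x).2 _ = (e _).2 at h2
  change _ ↔ Polynomial.eval (e x).1 _ = 0 ∧ Polynomial.eval (e x).2 _ = 0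
  rw [h1, h2, ← EmbeddingLike.map_eq_zero_iff (f := e), Prod.ext_iff]
  rfl

lemma fP_le (P : Polynomial ℤ) (m : ℕ) : fP P m ≤ m := by
  refine (Finset.card_filter_le _ _).trans ?_
  simp

lemma fP_one (P : Polynomial ℤ) : fP P 1 = 1 := by
  simp [fP]

/-- The arithmetic factor `μ(d) f_P(d) / d`. -/
noncomputable def gP (P : Polynomial ℤ) (d : ℕ) : ℂ :=
  (ArithmeticFunction.moebius d : ℂ) * (fP P d : ℂ) / (d : ℂ)

lemma norm_gP_le (P : Polynomial ℤ) (d : ℕ) : ‖gP P d‖ ≤ 1 := by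
  unfold gP
  rw [norm_div, norm_mul, Complex.norm_natCast, Complex.norm_natCast, Complex.norm_intCast]
  have h1 : |((ArithmeticFunction.moebius d : ℤ) : ℝ)| ≤ 1 := by
    exact_mod_cast ArithmeticFunction.abs_moebius_le_one
  have h2 : (fP P d : ℝ) ≤ d := by exact_mod_cast fP_le P d
  refine div_le_one_of_le₀ ?_ (by positivity)
  calc _ ≤ 1 * (d : ℝ) := by gcongr
    _ = d := one_mul _

lemma gP_zero (P : Polynomial ℤ) : gP P 0 = 0 := by simp [gP]

lemma gP_one (P : Polynomial ℤ) : gP P 1 = 1 := by simp [gP, fP_one]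

lemma gP_mul (P : Polynomial ℤ) {m n : ℕ} (h : m.Coprime n) :
    gP P (m * n) = gP P m * gP P n := by
  rcases eq_or_ne m 0 with rfl | hm
  · simp [gP_zero]
  rcases eq_or_ne n 0 with rfl | hn
  · simp [gP_zero]
  unfold gP
  rw [fP_mul P hm hn h, ArithmeticFunction.isMultiplicative_moebius.map_mul_of_coprime h]
  push_cast
  rw [div_mul_div_comm]
  ring

lemma Kfun_eq_conv (P : Polynomial ℤ) : Kfun P = LSeries.convolution 1 (gP P) := by
  rw [LSeries.convolution_def]
  funext n
  rw [Nat.sum_divisorsAntidiagonal' (fun a b => (1 : ℕ → ℂ) a * gP P b)]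
  simp [Kfun, gP]

/-- **Lemma (Dirichlet series identity).** For `Re(s) > 2`, the series
`Σ_n χ(n) K(n) n^{1-s}` converges absolutely, the Euler product
`∏_p (1 − χ(p) f_P(p) p^{-s})` converges absolutely, and
`Σ_n χ(n) K(n) n^{1-s} = L(s−1, χ) ∏_p (1 − χ(p) f_P(p) p^{-s})`. -/
theorem dirichletSeries_Kfun (ν : ℕ) (hν : 1 ≤ ν) (c : ℕ → ℤ) (hcν : c ν ≠ 0)
    (P : Polynomial ℤ)
    (hP : P = ∑ i ∈ Finset.Icc 1 ν, Polynomial.C (c i) * Polynomial.X ^ i)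
    (hdisc : (P.map (Int.castRingHom ℚ)).Separable)
    (q : ℕ) [NeZero q] (χ : DirichletCharacter ℂ q) (s : ℂ) (hs : 2 < s.re) :
    Summable (fun n : ℕ => ‖χ (n : ZMod q) * Kfun P n * (n : ℂ) ^ ((1 : ℂ) - s)‖) ∧
    Multipliable (fun p : Nat.Primes =>
      (1 : ℂ) - χ (((p : ℕ) : ZMod q)) * (fP P (p : ℕ) : ℂ) * ((p : ℕ) : ℂ) ^ (-s)) ∧
    ∑' n : ℕ, χ (n : ZMod q) * Kfun P n * (n : ℂ) ^ ((1 : ℂ) - s) =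
      DirichletCharacter.LFunction χ (s - 1) *
        ∏' p : Nat.Primes,
          ((1 : ℂ) - χ (((p : ℕ) : ZMod q)) * (fP P (p : ℕ) : ℂ) * ((p : ℕ) : ℂ) ^ (-s)) := by
  clear hν hcν hP hdisc
  have ht : 1 < (s - 1).re := by simp; linarith
  set G : ℕ → ℂ := ((χ ·) : ℕ → ℂ) * gP P with hG
  have hG0 : G 0 = 0 := by simp [hG, gP_zero]
  have hK : ((χ ·) : ℕ → ℂ) * Kfun P = LSeries.convolution (χ ·) G := by
    rw [Kfun_eq_conv, hG, ← DirichletCharacter.mul_convolution_distrib, mul_one]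
  have hK0 : (((χ ·) : ℕ → ℂ) * Kfun P) 0 = 0 := by simp [Kfun]
  have hterm : (fun n : ℕ => χ (n : ZMod q) * Kfun P n * (n : ℂ) ^ ((1 : ℂ) - s)) =
      LSeries.term (((χ ·) : ℕ → ℂ) * Kfun P) (s - 1) := by
    funext n
    rw [LSeries.term_def₀ hK0, neg_sub]
    rfl
  have hsχ : LSeriesSummable (χ ·) (s - 1) :=
    DirichletCharacter.LSeriesSummable_of_one_lt_re χ ht
  have hsG : LSeriesSummable G (s - 1) := by
    refine LSeriesSummable_of_bounded_of_one_lt_re (m := 1) (fun n _ => ?_) ht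
    rw [hG, Pi.mul_apply, norm_mul]
    exact mul_le_one₀ (DirichletCharacter.norm_le_one χ _) (norm_nonneg _) (norm_gP_le P n)
  have hGn : ∀ n : ℕ, LSeries.term G (s - 1) n = χ (n : ZMod q) * gP P n * (n : ℂ) ^ (-(s - 1)) :=
    fun n => LSeries.term_def₀ hG0 _ _
  have hprod : HasProd (fun p : Nat.Primes =>
      (1 : ℂ) - χ (((p : ℕ) : ZMod q)) * (fP P (p : ℕ) : ℂ) * ((p : ℕ) : ℂ) ^ (-s))
      (LSeries G (s - 1)) := by
    have h := EulerProduct.eulerProduct_hasProd (f := LSeries.term G (s - 1))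
      (by rw [hGn]; simp [gP_one])
      (by
        intro m n hmn
        simp only [hGn, gP_mul P hmn, Nat.cast_mul, map_mul,
          Complex.natCast_mul_natCast_cpow]
        ring)
      hsG.norm (by simp)
    change HasProd _ (∑' n, LSeries.term G (s - 1) n)
    convert h using 1
    funext p
    symm
    have hp := p.2
    rw [tsum_eq_sum (s := Finset.range 2)]
    · rw [Finset.sum_range_succ, Finset.sum_range_one]
      have hp0 : ((p : ℕ) : ℂ) ≠ 0 := by exact_mod_cast hp.ne_zero
      simp only [hGn, pow_zero, pow_one, gP_one]
      rw [gP, ArithmeticFunction.moebius_apply_prime hp, neg_sub, sub_eq_add_neg 1 s,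
        Complex.cpow_add _ _ hp0, Complex.cpow_one]
      simp only [Nat.cast_one, map_one, Complex.one_cpow, Int.cast_neg, Int.cast_one]
      field_simp
      ring
    · intro e he
      have he2 : 2 ≤ e := by
        by_contra hc
        exact he (Finset.mem_range.2 (by omega))
      have : gP P ((p : ℕ) ^ e) = 0 := by
        rw [gP, ArithmeticFunction.moebius_apply_prime_pow hp (by omega), if_neg (by omega)]
        simp
      simp [hGn, this]
  refine ⟨?_, hprod.multipliable, ?_⟩
  · have : LSeriesSummable (((χ ·) : ℕ → ℂ) * Kfun P) (s - 1) := by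
      rw [hK]; exact hsχ.convolution hsG
    have h2 := Summable.norm this
    rw [← hterm] at h2
    exact h2
  · rw [hprod.tprod_eq, DirichletCharacter.LFunction_eq_LSeries χ ht,
      ← LSeries_convolution' hsχ hsG, ← hK, hterm]
    rfl
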